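/- arXiv:math/0309364 — 2 statements merged into one kernel-verified Lean document; each statement's English description precedes it below -/
import Mathlib

section
/- Let (W,S) be an irreducible simply laced Coxeter system, let K be a convex subset of W containing the identity element, and let f ∈ V be K-generic with ⟨f,α_s⟩ ∈ ℤ for all s ∈ S. Let F be a field of characteristic zero and q ∈ F with q ≠ 0 and q^m ≠ 1 for all integers m ≥ 1. Define ȧ_t := 1/[⟨f,α_t⟩]_q for t ∈ T_K ∪ T_∂K and ä_t := (1−q) − ȧ_t for t ∈ T_K. Then for any choice of scalars ḃ_t, b̈_t ∈ F (t ∈ T_K) satisfying ḃ_t·b̈_t = (1 − ȧ_t)(1 − ä_t), the F-linear endomorphisms ρ_s of V_K defined for s ∈ S and w ∈ K by ρ_s(C_w) = ȧ_{wsw⁻¹}·C_w + ḃ_{wsw⁻¹}·C_{ws} if ℓ(w) < ℓ(ws) and ws ∈ K, ρ_s(C_w) = ȧ_{wsw⁻¹}·C_w if ℓ(w) < ℓ(ws) and ws ∉ K, and ρ_s(C_w) = ä_{wsw⁻¹}·C_w + b̈_{wsw⁻¹}·C_{ws} if ℓ(w) > ℓ(ws) (in which case ws ∈ K), satisfy the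 braid relations of (W,S) and the Hecke relations (ρ_s − 1)(ρ_s + q) = 0 for all s ∈ S; moreover the resulting pair (ρ,K) is a minimal AY pair (no subset K' with ∅ ⊊ K' ⊊ K has span{C_w : w ∈ K'} invariant under all ρ_s). -/
open CoxeterSystem

variable {B W : Type*} [Group W] {M : CoxeterMatrix B}

/-- The basis vector `C_w` of the vector space `V_K` spanned by `{C_w : w ∈ K}`,
realized as finitely supported functions on the subtype `K`. -/
noncomputable def Cvec (F : Type*) [Field F] (K : Set W) (w : W) (hw : w ∈ K) : ↥K →₀ F :=
  Finsupp.single ⟨w, hw⟩ 1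

/-- `T_K`: reflections of the form `w s w⁻¹` with `w ∈ K` and `ws ∈ K`. -/
def TK (cs : CoxeterSystem M W) (K : Set W) : Set W :=
  {t | ∃ (i : B) (w : W), w ∈ K ∧ w * cs.simple i ∈ K ∧ t = w * cs.simple i * w⁻¹}

/-- `T_∂K`: reflections of the form `w s w⁻¹` with `w ∈ K` and `ws ∉ K`. -/
def TbK (cs : CoxeterSystem M W) (K : Set W) : Set W :=
  {t | ∃ (i : B) (w : W), w ∈ K ∧ w * cs.simple i ∉ K ∧ t = w * cs.simple i * w⁻¹}

/-- A subset `K` of `W` is convex in the right Cayley graph: for all `x, y ∈ K`,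
every geodesic from `x` to `y` has all of its vertices in `K`. -/
def IsConvex (cs : CoxeterSystem M W) (K : Set W) : Prop :=
  ∀ x ∈ K, ∀ y ∈ K, ∀ l : List B, x * cs.wordProd l = y →
    l.length = cs.length (x⁻¹ * y) →
    ∀ n ≤ l.length, x * cs.wordProd (l.take n) ∈ K

/-- `(W,S)` is simply laced: `m(s,t) ≤ 3` for all `s,t ∈ S` (and `m(s,t) ≠ ∞`). -/
def SimplyLaced (M : CoxeterMatrix B) : Prop :=
  ∀ i j : B, i ≠ j → M i j = 2 ∨ M i j = 3

/-- `(W,S)` is irreducible: the Coxeter graph is connected. -/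
def IrreducibleCox (M : CoxeterMatrix B) : Prop :=
  ∀ i j : B, Relation.ReflTransGen (fun a b => M a b = 3) i j

/-- The canonical bilinear form `B(α_i, α_j) = −cos(π / m(i,j))` on the root space
`V = B → ℝ`, extended bilinearly.  (Here `m(i,j) = 0` encodes `m(i,j) = ∞`, and division
by zero yields `−cos 0 = −1`, as required.) -/
noncomputable def bform (M : CoxeterMatrix B) [Fintype B] (u v : B → ℝ) : ℝ :=
  ∑ i, ∑ j, u i * v j * (-(Real.cos (Real.pi / (M i j : ℝ))))

/-- `f` is `K`-generic (with respect to the positive definite form `ip` and the system of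
positive roots `αT`):
(i) `⟨f, α_t⟩ ∉ {0, 1, −1}` for `t ∈ T_K`;
(ii) `⟨f, α_t⟩ ∈ {1, −1}` for `t ∈ T_∂K`;
(iii) if `w ∈ K`, `m(s,t) = 3` and `ws, wt ∉ K` then `⟨f, α_{wsw⁻¹}⟩ = ⟨f, α_{wtw⁻¹}⟩`. -/
def KGeneric (cs : CoxeterSystem M W) (K : Set W)
    (ip : (B → ℝ) →ₗ[ℝ] (B → ℝ) →ₗ[ℝ] ℝ) (αT : W → (B → ℝ)) (f : B → ℝ) : Prop :=
  (∀ t ∈ TK cs K, ip f (αT t) ≠ 0 ∧ ip f (αT t) ≠ 1 ∧ ip f (αT t) ≠ -1) ∧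
  (∀ t ∈ TbK cs K, ip f (αT t) = 1 ∨ ip f (αT t) = -1) ∧
  (∀ w ∈ K, ∀ i j : B, M i j = 3 → w * cs.simple i ∉ K → w * cs.simple j ∉ K →
    ip f (αT (w * cs.simple i * w⁻¹)) = ip f (αT (w * cs.simple j * w⁻¹)))

/-- The span of `{C_w : w ∈ K'}` inside `V_K`. -/
noncomputable def spanOf (F : Type*) [Field F] (K : Set W) (K' : Set W) :
    Submodule F (↥K →₀ F) :=
  Submodule.span F {x | ∃ (w : W) (h : w ∈ K), w ∈ K' ∧ x = Cvec F K w h}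

/-- The alternating product `x y x y ⋯` with `m` factors, starting with `x`. -/
def altProd {E : Type*} [Monoid E] (x y : E) : ℕ → E
  | 0 => 1
  | n + 1 => x * altProd y x n

/-- The `q`-integer `[k]_q = (1 − q^k)/(1 − q)` of a real number `x`, defined when `x`
is an integer (and `0` otherwise). -/
noncomputable def qIntR {F : Type*} [Field F] (q : F) (x : ℝ) : F :=
  open Classical in
  if h : ∃ k : ℤ, (k : ℝ) = x then (1 - q ^ (Classical.choose h)) / (1 - q) else 0

section SimplyLacedRoots

theorem bform_single [DecidableEq B] [Fintype B] (i j : B) :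
    bform M (Pi.single i 1) (Pi.single j 1) = -Real.cos (Real.pi / (M i j : ℝ)) := by
  simp [bform, Pi.single_apply]

/-- Simple reflections act on simple roots as in the simply laced geometric representation. -/
structure ActsByReflections [DecidableEq B] (cs : CoxeterSystem M W)
    (σ : Representation ℝ W (B → ℝ)) : Prop where
  self : ∀ i, σ (cs.simple i) (Pi.single i 1) = -Pi.single i 1
  two : ∀ i j, M i j = 2 → σ (cs.simple i) (Pi.single j 1) = Pi.single j 1
  three : ∀ i j, M i j = 3 → σ (cs.simple i) (Pi.single j 1) = Pi.single j 1 + Pi.single i 1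

theorem actsByReflections_of_bform [DecidableEq B] [Fintype B] (cs : CoxeterSystem M W)
    (σ : Representation ℝ W (B → ℝ))
    (hσ : ∀ (i : B) (v : B → ℝ),
      σ (cs.simple i) v =
        v - (2 * bform M v (Pi.single i 1 : B → ℝ)) • (Pi.single i 1 : B → ℝ)) :
    ActsByReflections cs σ where
  self i := by
    rw [hσ, bform_single, M.diagonal]
    simp only [Nat.cast_one, div_one, Real.cos_pi]
    module
  two i j h := by
    rw [hσ, bform_single, M.symmetric, h]
    simp
  three i j h := by
    rw [hσ, bform_single, M.symmetric, h]
    simp only [Nat.cast_ofNat, Real.cos_pi_div_three]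
    module

theorem simple_comm_of_two (cs : CoxeterSystem M W) {i j : B} (h : M i j = 2) :
    cs.simple i * cs.simple j = cs.simple j * cs.simple i := by
  have h1 := cs.simple_mul_simple_pow i j
  rw [h, pow_two, mul_eq_one_iff_eq_inv] at h1
  simpa using h1

theorem simple_braid_of_three (cs : CoxeterSystem M W) {i j : B} (h : M i j = 3) :
    cs.simple i * cs.simple j * cs.simple i = cs.simple j * cs.simple i * cs.simple j := by
  have h1 := cs.simple_mul_simple_pow i j
  have h2 : cs.simple i * cs.simple j * cs.simple i *
      (cs.simple j * cs.simple i * cs.simple j) = 1 := by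
    rw [h] at h1
    simpa [pow_succ, mul_assoc] using h1
  rw [mul_eq_one_iff_eq_inv] at h2
  simpa [mul_assoc] using h2

/-- Every element is a minimal left coset representative times one of the six elements of a
parabolic subgroup of type `A₂`. -/
theorem exists_minimal_coset_rep (cs : CoxeterSystem M W) {i j : B} (h : M i j = 3) (x : W) :
    ∃ w, cs.length w < cs.length (w * cs.simple i) ∧ cs.length w < cs.length (w * cs.simple j) ∧
      (x = w ∨ x = w * cs.simple i ∨ x = w * cs.simple j ∨ x = w * cs.simple i * cs.simple j ∨
        x = w * cs.simple j * cs.simple i ∨ x = w * cs.simple i * cs.simple j * cs.simple i) := by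
  induction hn : cs.length x using Nat.strong_induction_on generalizing x with
  | _ n ih =>
  subst hn
  have hb : ∀ w, w * cs.simple i * cs.simple j * cs.simple i
      = w * cs.simple j * cs.simple i * cs.simple j := fun w => by
    simpa [mul_assoc] using congrArg (w * ·) (simple_braid_of_three cs h)
  have h1 := cs.length_mul_simple x i
  have h2 := cs.length_mul_simple x j
  by_cases hi : cs.length (x * cs.simple i) < cs.length x
  · obtain ⟨w, hw1, hw2, hw⟩ := ih _ hi (x * cs.simple i) rfl
    refine ⟨w, hw1, hw2, ?_⟩
    have e : x = x * cs.simple i * cs.simple i := by simp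
    rw [e]
    rcases hw with e | e | e | e | e | e <;> simp only [e, true_or, or_true,
      simple_mul_simple_cancel_right]
  · by_cases hj : cs.length (x * cs.simple j) < cs.length x
    · obtain ⟨w, hw1, hw2, hw⟩ := ih _ hj (x * cs.simple j) rfl
      refine ⟨w, hw1, hw2, ?_⟩
      have e : x = x * cs.simple j * cs.simple j := by simp
      rw [e]
      rcases hw with e | e | e | e | e | e
      · simp only [e, true_or, or_true]
      · simp only [e, true_or, or_true]
      · simp only [e, true_or, simple_mul_simple_cancel_right]
      · simp only [e, true_or, or_true, simple_mul_simple_cancel_right]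
      · simp only [e, hb, or_true]
      · simp only [e, hb, true_or, or_true, simple_mul_simple_cancel_right]
    · exact ⟨x, by omega, by omega, Or.inl rfl⟩

variable [DecidableEq B] {cs : CoxeterSystem M W} {σ : Representation ℝ W (B → ℝ)}

theorem ActsByReflections.nonneg (hσ : ActsByReflections cs σ) (hsl : SimplyLaced M)
    (w : W) (i : B) (h : cs.length w < cs.length (w * cs.simple i)) :
    0 ≤ σ w (Pi.single i 1) := by
  induction hn : cs.length w using Nat.strong_induction_on generalizing w i with
  | _ n ih =>
  subst hn
  by_cases hw : w = 1
  · simp [hw]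
  obtain ⟨j, hj⟩ := cs.exists_rightDescent_of_ne_one hw
  unfold IsRightDescent at hj
  have hij : i ≠ j := by rintro rfl; omega
  obtain ⟨v, rfl⟩ : ∃ v, w = v * cs.simple j := ⟨w * cs.simple j, by simp⟩
  simp only [simple_mul_simple_cancel_right] at hj
  have hvj := cs.length_mul_simple v j
  rcases hsl j i hij.symm with h2 | h3
  · rw [map_mul, Module.End.mul_apply, hσ.two _ _ h2]
    refine ih _ (by omega) v i ?_ rfl
    by_contra hlt
    have h4 := cs.length_mul_simple v i
    have h5 := cs.length_mul_simple (v * cs.simple i) j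
    rw [mul_assoc, simple_comm_of_two cs h2, ← mul_assoc] at h
    omega
  · rw [map_mul, Module.End.mul_apply, hσ.three _ _ h3, map_add]
    rcases cs.length_mul_simple v i with h4 | h4
    · exact add_nonneg (ih _ (by omega) v i (by omega) rfl) (ih _ (by omega) v j (by omega) rfl)
    · obtain ⟨u, rfl⟩ : ∃ u, v = u * cs.simple i := ⟨v * cs.simple i, by simp⟩
      simp only [simple_mul_simple_cancel_right] at h4
      rw [map_mul, Module.End.mul_apply, Module.End.mul_apply, hσ.self,
        hσ.three _ _ (M.symmetric i j ▸ h3), map_neg, map_add, neg_add_cancel_comm_assoc]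
      refine ih _ (by omega) u j ?_ rfl
      by_contra hlt
      have h5 := cs.length_mul_simple u j
      obtain ⟨t, rfl⟩ : ∃ t, u = t * cs.simple j := ⟨u * cs.simple j, by simp⟩
      simp only [simple_mul_simple_cancel_right] at h5 hlt
      have h6 : t * cs.simple j * cs.simple i * cs.simple j * cs.simple i
          = t * cs.simple i * cs.simple j := by
        have := simple_braid_of_three cs h3
        simp only [mul_assoc] at this ⊢
        rw [← mul_assoc, ← mul_assoc (cs.simple i), ← mul_assoc, ← mul_assoc, mul_assoc t,
          mul_assoc t, mul_assoc (cs.simple j), this]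
        simp [mul_assoc]
      rw [h6] at h
      have h7 := cs.length_mul_simple (t * cs.simple i) j
      have h8 := cs.length_mul_simple t i
      omega

theorem ActsByReflections.mul_self_apply (hσ : ActsByReflections cs σ) (w : W) (i : B) :
    σ (w * cs.simple i) (Pi.single i 1) = -σ w (Pi.single i 1) := by
  rw [map_mul, Module.End.mul_apply, hσ.self, map_neg]

theorem ActsByReflections.lt_iff (hσ : ActsByReflections cs σ) (hsl : SimplyLaced M)
    (w : W) (i : B) :
    cs.length w < cs.length (w * cs.simple i) ↔ 0 ≤ σ w (Pi.single i 1) := by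
  refine ⟨hσ.nonneg hsl w i, fun h => ?_⟩
  by_contra hlt
  have h1 := cs.length_mul_simple w i
  have h2 := hσ.nonneg hsl (w * cs.simple i) i (by simp; omega)
  rw [hσ.mul_self_apply, neg_nonneg] at h2
  have h3 : σ w⁻¹ (σ w (Pi.single i 1)) = Pi.single i 1 := by
    rw [← Module.End.mul_apply, ← map_mul]; simp
  rw [le_antisymm h2 h, map_zero] at h3
  simpa using congrFun h3 i

/-- A linear form that is integral on simple roots is integral on all roots. -/
theorem ActsByReflections.exists_int (hσ : ActsByReflections cs σ) (hsl : SimplyLaced M)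
    (φ : (B → ℝ) →ₗ[ℝ] ℝ) (hφ : ∀ i, ∃ k : ℤ, (k : ℝ) = φ (Pi.single i 1)) (w : W) (i : B) :
    ∃ k : ℤ, (k : ℝ) = φ (σ w (Pi.single i 1)) := by
  induction w using cs.simple_induction_right generalizing i with
  | one => simpa using hφ i
  | mul_simple_right w j ih =>
    by_cases hij : j = i
    · subst hij
      obtain ⟨k, hk⟩ := ih j
      exact ⟨-k, by rw [hσ.mul_self_apply, map_neg, ← hk, Int.cast_neg]⟩
    rw [map_mul, Module.End.mul_apply]
    rcases hsl j i hij with h | h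
    · rw [hσ.two _ _ h]; exact ih i
    · obtain ⟨k, hk⟩ := ih i
      obtain ⟨l, hl⟩ := ih j
      exact ⟨k + l, by rw [hσ.three _ _ h, map_add, map_add, ← hk, ← hl, Int.cast_add]⟩

end SimplyLacedRoots

section QIntegers

variable {F : Type*} [Field F] {q : F}

theorem zpow_ne_one_of_pow_ne_one (hq : ∀ m : ℕ, 1 ≤ m → q ^ m ≠ 1) {k : ℤ} (hk : k ≠ 0) :
    q ^ k ≠ 1 := by
  obtain ⟨n, rfl | rfl⟩ := k.eq_nat_or_neg
  · simpa using hq n (by omega)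
  · simpa using hq n (by omega)

theorem qIntR_intCast (q : F) (k : ℤ) : qIntR q (k : ℝ) = (1 - q ^ k) / (1 - q) := by
  have h : ∃ l : ℤ, (l : ℝ) = k := ⟨k, rfl⟩
  have h2 : Classical.choose h = k := by exact_mod_cast Classical.choose_spec h
  rw [qIntR, dif_pos h, h2]

theorem inv_qIntR_one (hq : ∀ m : ℕ, 1 ≤ m → q ^ m ≠ 1) : (qIntR q 1)⁻¹ = 1 := by
  have h := qIntR_intCast q 1
  have h1 : 1 - q ≠ 0 := sub_ne_zero.2 (by simpa using (hq 1 le_rfl).symm)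
  rw [Int.cast_one] at h
  rw [h, zpow_one, div_self h1, inv_one]

theorem inv_qIntR_neg_one (hq0 : q ≠ 0) (hq : ∀ m : ℕ, 1 ≤ m → q ^ m ≠ 1) :
    (qIntR q (-1))⁻¹ = -q := by
  have h := qIntR_intCast q (-1)
  have h1 : 1 - q ≠ 0 := sub_ne_zero.2 (by simpa using (hq 1 le_rfl).symm)
  have h2 : q - 1 ≠ 0 := by rw [← neg_sub]; exact neg_ne_zero.2 h1
  rw [Int.cast_neg, Int.cast_one] at h
  rw [h, zpow_neg_one]
  field_simp
  ring

theorem inv_qIntR_ne (hq0 : q ≠ 0) (hq : ∀ m : ℕ, 1 ≤ m → q ^ m ≠ 1) {k : ℤ}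
    (h0 : k ≠ 0) (h1 : k ≠ 1) (h2 : k ≠ -1) :
    (qIntR q (k : ℝ))⁻¹ ≠ 1 ∧ (qIntR q (k : ℝ))⁻¹ ≠ -q := by
  have hq1 : 1 - q ≠ 0 := sub_ne_zero.2 (by simpa using (hq 1 le_rfl).symm)
  have hk0 : 1 - q ^ k ≠ 0 := sub_ne_zero.2 (zpow_ne_one_of_pow_ne_one hq h0).symm
  rw [qIntR_intCast, inv_div]
  refine ⟨fun h => ?_, fun h => ?_⟩
  · rw [div_eq_one_iff_eq hk0] at h
    apply zpow_ne_one_of_pow_ne_one hq (sub_ne_zero.2 h1)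
    rw [zpow_sub_one₀ hq0]
    field_simp
    linear_combination h
  · rw [div_eq_iff hk0] at h
    apply zpow_ne_one_of_pow_ne_one hq (k := k + 1) (by omega)
    rw [zpow_add_one₀ hq0]
    linear_combination -h

theorem inv_qIntR_mul (hq0 : q ≠ 0) (hq : ∀ m : ℕ, 1 ≤ m → q ^ m ≠ 1) {k l : ℤ}
    (hk : k ≠ 0) (hl : l ≠ 0) (hkl : k + l ≠ 0) :
    (qIntR q (k : ℝ))⁻¹ * (qIntR q (l : ℝ))⁻¹ =
      (qIntR q ((k + l : ℤ) : ℝ))⁻¹ *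
        ((qIntR q (k : ℝ))⁻¹ + (qIntR q (l : ℝ))⁻¹ - (1 - q)) := by
  have hq1 : 1 - q ≠ 0 := sub_ne_zero.2 (by simpa using (hq 1 le_rfl).symm)
  have h1 : 1 - q ^ k ≠ 0 := sub_ne_zero.2 (zpow_ne_one_of_pow_ne_one hq hk).symm
  have h2 : 1 - q ^ l ≠ 0 := sub_ne_zero.2 (zpow_ne_one_of_pow_ne_one hq hl).symm
  have h3 : 1 - q ^ (k + l) ≠ 0 := sub_ne_zero.2 (zpow_ne_one_of_pow_ne_one hq hkl).symm
  simp only [qIntR_intCast, inv_div]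
  rw [zpow_add₀ hq0] at *
  generalize q ^ k = a at *
  generalize q ^ l = b at *
  field_simp
  ring

end QIntegers

section LocalRelations

variable {F E : Type*} [Field F] [AddCommGroup E] [Module F E]

theorem hecke_of_two_vectors {S : Module.End F E} {q a b b' : F} {u u' : E}
    (hb : b * b' = (1 - a) * (1 - ((1 - q) - a)))
    (h : S u = a • u + b • u') (h' : S u' = ((1 - q) - a) • u' + b' • u) :
    ((S - 1) * (S + q • 1)) u = 0 ∧ ((S - 1) * (S + q • 1)) u' = 0 := by
  constructor <;>
  · simp only [Module.End.mul_apply, LinearMap.sub_apply, LinearMap.add_apply,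
      LinearMap.smul_apply, Module.End.one_apply, map_add, map_smul, h, h']
    match_scalars
    · linear_combination hb
    · ring

theorem braid_of_six_vectors {S T : Module.End F E} {q x y z bx bx' b_y b_y' bz bz' : F}
    {v₀ v₁ v₂ v₃ v₄ v₅ : E}
    (hbx : bx * bx' = (1 - x) * (1 - ((1 - q) - x)))
    (hb_y : b_y * b_y' = (1 - y) * (1 - ((1 - q) - y)))
    (hbz : bz * bz' = (1 - z) * (1 - ((1 - q) - z)))
    (hxyz : x * y = z * (x + y - (1 - q)))
    (hS₀ : S v₀ = x • v₀ + bx • v₁) (hT₀ : T v₀ = y • v₀ + b_y • v₂)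
    (hS₁ : S v₁ = ((1 - q) - x) • v₁ + bx' • v₀) (hT₁ : T v₁ = z • v₁ + bz • v₃)
    (hT₂ : T v₂ = ((1 - q) - y) • v₂ + b_y' • v₀) (hS₂ : S v₂ = z • v₂ + bz • v₄)
    (hT₃ : T v₃ = ((1 - q) - z) • v₃ + bz' • v₁) (hS₃ : S v₃ = y • v₃ + b_y • v₅)
    (hS₄ : S v₄ = ((1 - q) - z) • v₄ + bz' • v₂) (hT₄ : T v₄ = x • v₄ + bx • v₅)
    (hS₅ : S v₅ = ((1 - q) - y) • v₅ + b_y' • v₃)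
    (hT₅ : T v₅ = ((1 - q) - x) • v₅ + bx' • v₄) :
    S (T (S v₀)) = T (S (T v₀)) ∧ S (T (S v₁)) = T (S (T v₁)) ∧
      S (T (S v₂)) = T (S (T v₂)) ∧ S (T (S v₃)) = T (S (T v₃)) ∧
      S (T (S v₄)) = T (S (T v₄)) ∧ S (T (S v₅)) = T (S (T v₅)) := by
  refine ⟨?_, ?_, ?_, ?_, ?_, ?_⟩ <;>
  simp only [hS₀, hS₁, hS₂, hS₃, hS₄, hS₅, hT₀, hT₁, hT₂, hT₃, hT₄, hT₅, map_add, map_smul] <;>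
  match_scalars
  all_goals first | ring1 | grind

end LocalRelations

section EdgeActions

variable {F E : Type*} [Field F] [AddCommGroup E] [Module F E]

/-- Operators `ρ i` acting on a family of vectors indexed by `W` along the edges of the right
Cayley graph, with coefficients depending only on the reflection attached to the edge. -/
structure EdgeAction (cs : CoxeterSystem M W) (q : F) (a b b' : W → F) (v : W → E)
    (ρ : B → Module.End F E) : Prop where
  up : ∀ i w, cs.length w < cs.length (w * cs.simple i) →
    ρ i (v w) = a (w * cs.simple i * w⁻¹) • v w +
      b (w * cs.simple i * w⁻¹) • v (w * cs.simple i)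
  down : ∀ i w, cs.length w < cs.length (w * cs.simple i) →
    ρ i (v (w * cs.simple i)) = ((1 - q) - a (w * cs.simple i * w⁻¹)) • v (w * cs.simple i) +
      b' (w * cs.simple i * w⁻¹) • v w

variable {cs : CoxeterSystem M W} {q : F} {a b b' : W → F} {v : W → E} {ρ : B → Module.End F E}
  [DecidableEq B] {σ : Representation ℝ W (B → ℝ)}

theorem EdgeAction.comm_apply (h : EdgeAction cs q a b b' v ρ) (hσ : ActsByReflections cs σ)
    (hsl : SimplyLaced M) {i j : B} (hM : M i j = 2) (x : W) :
    ρ i (ρ j (v x)) = ρ j (ρ i (v x)) := by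
  have key : ∀ k l : B, M k l = 2 → ∃ c d : F, ρ k (v x) = c • v x + d • v (x * cs.simple k) ∧
      ρ k (v (x * cs.simple l)) =
        c • v (x * cs.simple l) + d • v (x * cs.simple k * cs.simple l) := by
    intro k l hkl
    have hc := simple_comm_of_two cs hkl
    have hlk : M l k = 2 := M.symmetric k l ▸ hkl
    have hroot : σ (x * cs.simple l) (Pi.single k 1) = σ x (Pi.single k 1) := by
      rw [map_mul, Module.End.mul_apply, hσ.two _ _ hlk]
    have hx : x * cs.simple k * cs.simple l = x * cs.simple l * cs.simple k := by
      rw [mul_assoc, hc, mul_assoc]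
    have hiff : cs.length (x * cs.simple l) < cs.length (x * cs.simple l * cs.simple k) ↔
        cs.length x < cs.length (x * cs.simple k) := by
      rw [hσ.lt_iff hsl, hσ.lt_iff hsl, hroot]
    by_cases hlt : cs.length x < cs.length (x * cs.simple k)
    · have ht : x * cs.simple l * cs.simple k * (x * cs.simple l)⁻¹ =
          x * cs.simple k * x⁻¹ := by
        rw [← hx]; simp [mul_assoc]
      refine ⟨_, _, h.up k x hlt, ?_⟩
      rw [h.up k _ (hiff.2 hlt), ht, hx]
    · have h1 := cs.length_mul_simple x k
      have h2 := cs.length_mul_simple (x * cs.simple l) k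
      have e1 := h.down k (x * cs.simple k) (by simp; omega)
      have e2 := h.down k (x * cs.simple l * cs.simple k)
        (by simp only [simple_mul_simple_cancel_right]; omega)
      simp only [simple_mul_simple_cancel_right] at e1 e2
      have ht : x * cs.simple l * (x * cs.simple l * cs.simple k)⁻¹ =
          x * (x * cs.simple k)⁻¹ := by
        rw [← hx]; simp [mul_assoc]
      rw [ht, ← hx] at e2
      exact ⟨_, _, e1, e2⟩
  obtain ⟨c, d, h1, h2⟩ := key i j hM
  obtain ⟨c', d', h3, h4⟩ := key j i (M.symmetric i j ▸ hM)
  have hx : x * cs.simple i * cs.simple j = x * cs.simple j * cs.simple i := by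
    rw [mul_assoc, simple_comm_of_two cs hM, mul_assoc]
  simp only [h1, h2, h3, h4, map_add, map_smul, hx]
  module

theorem EdgeAction.braid_apply (h : EdgeAction cs q a b b' v ρ) (hσ : ActsByReflections cs σ)
    (hsl : SimplyLaced M) {i j : B} (hM : M i j = 3) {w : W}
    (hi : cs.length w < cs.length (w * cs.simple i))
    (hj : cs.length w < cs.length (w * cs.simple j))
    (hb : ∀ t, t = w * cs.simple i * w⁻¹ ∨ t = w * cs.simple j * w⁻¹ ∨
      t = w * cs.simple i * cs.simple j * (w * cs.simple i)⁻¹ →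
      b t * b' t = (1 - a t) * (1 - ((1 - q) - a t)))
    (ha : a (w * cs.simple i * w⁻¹) * a (w * cs.simple j * w⁻¹) =
      a (w * cs.simple i * cs.simple j * (w * cs.simple i)⁻¹) *
        (a (w * cs.simple i * w⁻¹) + a (w * cs.simple j * w⁻¹) - (1 - q)))
    {x : W} (hx : x = w ∨ x = w * cs.simple i ∨ x = w * cs.simple j ∨
      x = w * cs.simple i * cs.simple j ∨ x = w * cs.simple j * cs.simple i ∨
      x = w * cs.simple i * cs.simple j * cs.simple i) :
    ρ i (ρ j (ρ i (v x))) = ρ j (ρ i (ρ j (v x))) := by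
  have hM' : M j i = 3 := M.symmetric i j ▸ hM
  have hbr := simple_braid_of_three cs hM
  have ri := (hσ.lt_iff hsl _ _).1 hi
  have rj := (hσ.lt_iff hsl _ _).1 hj
  have hij : cs.length (w * cs.simple i) < cs.length (w * cs.simple i * cs.simple j) := by
    rw [hσ.lt_iff hsl, map_mul, Module.End.mul_apply, hσ.three _ _ hM, map_add]
    exact add_nonneg rj ri
  have hji : cs.length (w * cs.simple j) < cs.length (w * cs.simple j * cs.simple i) := by
    rw [hσ.lt_iff hsl, map_mul, Module.End.mul_apply, hσ.three _ _ hM', map_add]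
    exact add_nonneg ri rj
  have hiji : cs.length (w * cs.simple i * cs.simple j) <
      cs.length (w * cs.simple i * cs.simple j * cs.simple i) := by
    rw [hσ.lt_iff hsl, map_mul, map_mul, Module.End.mul_apply, Module.End.mul_apply,
      hσ.three _ _ hM', map_add, hσ.self, hσ.three _ _ hM]
    simpa using rj
  have hjij : cs.length (w * cs.simple j * cs.simple i) <
      cs.length (w * cs.simple j * cs.simple i * cs.simple j) := by
    rw [hσ.lt_iff hsl, map_mul, map_mul, Module.End.mul_apply, Module.End.mul_apply,
      hσ.three _ _ hM, map_add, hσ.self, hσ.three _ _ hM']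
    simpa using ri
  have e5 : w * cs.simple j * cs.simple i * cs.simple j =
      w * cs.simple i * cs.simple j * cs.simple i := by
    simpa [mul_assoc] using (congrArg (w * ·) hbr).symm
  have t2 : w * cs.simple j * cs.simple i * (w * cs.simple j)⁻¹ =
      w * cs.simple i * cs.simple j * (w * cs.simple i)⁻¹ := by
    rw [mul_inv_rev, mul_inv_rev, inv_simple, inv_simple, ← mul_assoc, ← mul_assoc, e5]
  have t3 : w * cs.simple i * cs.simple j * cs.simple i *
      (w * cs.simple i * cs.simple j)⁻¹ = w * cs.simple j * w⁻¹ := by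
    rw [← e5]; simp [mul_assoc]
  have t1 : w * cs.simple j * cs.simple i * cs.simple j *
      (w * cs.simple j * cs.simple i)⁻¹ = w * cs.simple i * w⁻¹ := by
    rw [e5]; simp [mul_assoc]
  have E1 := h.up j _ hij
  have E1' := h.down j _ hij
  have E2 := h.up i _ hji
  have E2' := h.down i _ hji
  have E3 := h.up i _ hiji
  have E3' := h.down i _ hiji
  have E4 := h.up j _ hjij
  have E4' := h.down j _ hjij
  rw [t2] at E2 E2'
  rw [t3] at E3 E3'
  rw [t1, e5] at E4 E4'
  obtain ⟨h0, h1, h2, h3, h4, h5⟩ := braid_of_six_vectors (hb _ (Or.inl rfl))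
    (hb _ (Or.inr (Or.inl rfl))) (hb _ (Or.inr (Or.inr rfl))) ha
    (h.up i w hi) (h.up j w hj) (h.down i w hi) E1 (h.down j w hj) E2 E1' E3 E2' E4 E3' E4'
  rcases hx with rfl | rfl | rfl | rfl | rfl | rfl <;> assumption

end EdgeActions

section ConvexSets

theorem IsConvex.mem_of_lt {cs : CoxeterSystem M W} {K : Set W} (hK : IsConvex cs K)
    (h1 : (1 : W) ∈ K) {w : W} {i : B} (h : cs.length w < cs.length (w * cs.simple i))
    (hw : w * cs.simple i ∈ K) : w ∈ K := by
  obtain ⟨l, hl, rfl⟩ := cs.exists_isReduced w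
  have h2 := cs.length_mul_simple (cs.wordProd l) i
  have h3 := hK 1 h1 _ hw (l ++ [i]) (by simp [wordProd_append])
    (by rw [hl.eq] at h h2; simp; omega) l.length (by simp)
  simpa using h3

theorem IsConvex.eq_of_closed {cs : CoxeterSystem M W} {K K' : Set W} (hK : IsConvex cs K)
    (hsub : K' ⊆ K) (hne : K'.Nonempty)
    (hcl : ∀ w ∈ K', ∀ i, w * cs.simple i ∈ K → w * cs.simple i ∈ K') : K' = K := by
  refine hsub.antisymm fun y hy => ?_
  obtain ⟨x, hx⟩ := hne
  obtain ⟨l, hl, hxy⟩ := cs.exists_isReduced (x⁻¹ * y)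
  have hmem := hK x (hsub hx) y hy l (by rw [← hxy]; simp) (by rw [hxy, hl.eq])
  have : ∀ n ≤ l.length, x * cs.wordProd (l.take n) ∈ K' := by
    intro n
    induction n with
    | zero => simpa using hx
    | succ n ih =>
      intro hn
      have h1 := hmem (n + 1) hn
      rw [List.take_succ_eq_append_getElem (by omega), wordProd_append, wordProd_singleton,
        ← mul_assoc] at h1 ⊢
      exact hcl _ (ih (by omega)) _ h1
  have h2 := this l.length le_rfl
  rw [List.take_length, ← hxy] at h2
  simpa using h2

theorem mem_of_mem_spanOf {X F : Type*} [Field F] {K K' : Set X} {x : ↥K →₀ F}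
    (hx : x ∈ spanOf F K K') {k : ↥K} (hk : x k ≠ 0) : (k : X) ∈ K' := by
  by_contra hk'
  refine hk ?_
  induction hx using Submodule.span_induction with
  | mem y hy =>
    obtain ⟨w, hw, hwK', rfl⟩ := hy
    refine Finsupp.single_eq_of_ne ?_
    rintro rfl
    exact hk' hwK'
  | zero => rfl
  | add y z _ _ hy hz => simp_all
  | smul c y _ hy => simp_all

theorem ext_Cvec {X F E : Type*} [Field F] [AddCommGroup E] [Module F E] {K : Set X}
    {S T : (↥K →₀ F) →ₗ[F] E} (h : ∀ w hw, S (Cvec F K w hw) = T (Cvec F K w hw)) : S = T :=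
  Finsupp.lhom_ext' fun k => LinearMap.ext_ring (h k k.2)

end ConvexSets

/-- `q`-analogue of STATEMENT 14: for an irreducible simply laced Coxeter
system, a convex `K ∋ 1`, and a `K`-generic `f` with integer values `⟨f,α_s⟩` on the simple
roots, the coefficients `ȧ_t = 1/[⟨f,α_t⟩]_q`, `ä_t = (1−q) − ȧ_t` and any `ḃ_t, b̈_t` with
`ḃ_t·b̈_t = (1 − ȧ_t)(1 − ä_t)` define operators satisfying the braid and Hecke relations,
and the resulting pair `(ρ, K)` is a minimal AY pair. -/
theorem stmt16 [DecidableEq B] [Fintype B] (cs : CoxeterSystem M W)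
    (hsl : SimplyLaced M) (hirr : IrreducibleCox M)
    (K : Set W) (hconv : IsConvex cs K) (h1K : (1 : W) ∈ K)
    -- the standard geometric representation σ of W on the root space V = B → ℝ
    (σ : Representation ℝ W (B → ℝ))
    (hσ : ∀ (i : B) (v : B → ℝ),
      σ (cs.simple i) v = v - (2 * bform M v (Pi.single i 1 : B → ℝ)) • (Pi.single i 1 : B → ℝ))
    -- an arbitrary positive definite bilinear form ⟨·,·⟩ on V
    (ip : (B → ℝ) →ₗ[ℝ] (B → ℝ) →ₗ[ℝ] ℝ)
    (hsymm : ∀ u v : B → ℝ, ip u v = ip v u)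
    (hpos : ∀ v : B → ℝ, v ≠ 0 → 0 < ip v v)
    -- the positive root α_t associated to each reflection t
    (αT : W → (B → ℝ))
    (hαT : ∀ (w : W) (i : B), cs.length w < cs.length (w * cs.simple i) →
      αT (w * cs.simple i * w⁻¹) = σ w (Pi.single i 1 : B → ℝ))
    (f : B → ℝ) (hf : KGeneric cs K ip αT f)
    (hfint : ∀ i : B, ∃ k : ℤ, (k : ℝ) = ip f (Pi.single i 1 : B → ℝ))
    (F : Type*) [Field F] [CharZero F]
    (q : F) (hq0 : q ≠ 0) (hqroot : ∀ m : ℕ, 1 ≤ m → q ^ m ≠ 1)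
    (bd bBar : W → F)
    (hb : ∀ t ∈ TK cs K,
      bd t * bBar t =
        (1 - (qIntR q (ip f (αT t)))⁻¹) * (1 - ((1 - q) - (qIntR q (ip f (αT t)))⁻¹)))
    (ρ : B → Module.End F (↥K →₀ F))
    (hρ : ∀ (i : B) (w : W) (hw : w ∈ K),
      (∀ h : w * cs.simple i ∈ K, cs.length w < cs.length (w * cs.simple i) →
        ρ i (Cvec F K w hw) =
          (qIntR q (ip f (αT (w * cs.simple i * w⁻¹))))⁻¹ • Cvec F K w hw +
          bd (w * cs.simple i * w⁻¹) • Cvec F K (w * cs.simple i) h) ∧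
      (w * cs.simple i ∉ K → cs.length w < cs.length (w * cs.simple i) →
        ρ i (Cvec F K w hw) =
          (qIntR q (ip f (αT (w * cs.simple i * w⁻¹))))⁻¹ • Cvec F K w hw) ∧
      (∀ h : w * cs.simple i ∈ K, cs.length (w * cs.simple i) < cs.length w →
        ρ i (Cvec F K w hw) =
          ((1 - q) - (qIntR q (ip f (αT (w * cs.simple i * w⁻¹))))⁻¹) • Cvec F K w hw +
          bBar (w * cs.simple i * w⁻¹) • Cvec F K (w * cs.simple i) h)) :
    (∀ i j : B, i ≠ j → M i j ≠ 0 →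
      altProd (ρ i) (ρ j) (M i j) = altProd (ρ j) (ρ i) (M i j)) ∧
    (∀ i : B, (ρ i - 1) * (ρ i + q • 1) = 0) ∧
    (∀ K' : Set W, K' ⊆ K → K'.Nonempty →
      (∀ (i : B), ∀ x ∈ spanOf F K K', ρ i x ∈ spanOf F K K') → K' = K) := by
  classical
  have hact := actsByReflections_of_bform cs σ hσ
  obtain ⟨hgen, hbdry, hcorner⟩ := hf
  set a : W → F := fun t => (qIntR q (ip f (αT t)))⁻¹ with ha
  set b' : W → F := fun t => if t ∈ TK cs K then bBar t else 0 with hb'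
  set v : W → (↥K →₀ F) := fun w => if hw : w ∈ K then Cvec F K w hw else 0 with hv
  have hvK : ∀ {w} (hw : w ∈ K), v w = Cvec F K w hw := fun hw => by simp [hv, hw]
  have hvK' : ∀ {w}, w ∉ K → v w = 0 := fun hw => by simp [hv, hw]
  have hdisj : ∀ t ∈ TbK cs K, t ∉ TK cs K := fun t ht ht' =>
    (hbdry t ht).elim (hgen t ht').2.1 (hgen t ht').2.2
  have hflip : ∀ (w : W) (i : B),
      w * cs.simple i * cs.simple i * (w * cs.simple i)⁻¹ = w * cs.simple i * w⁻¹ :=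
    fun w i => by simp [mul_assoc]
  have hdownK : ∀ {w : W} {i : B}, cs.length w < cs.length (w * cs.simple i) →
      w * cs.simple i ∈ K → w ∈ K := fun h hw => hconv.mem_of_lt h1K h hw
  have hedge : EdgeAction cs q a bd b' v ρ := by
    refine ⟨fun i w h => ?_, fun i w h => ?_⟩
    · by_cases hw : w ∈ K
      · by_cases hwi : w * cs.simple i ∈ K
        · rw [hvK hw, hvK hwi]
          exact (hρ i w hw).1 hwi h
        · rw [hvK hw, hvK' hwi, smul_zero, add_zero]
          exact (hρ i w hw).2.1 hwi h
      · rw [hvK' hw, hvK' fun hwi => hw (hdownK h hwi)]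
        simp
    · by_cases hwi : w * cs.simple i ∈ K
      · have hw := hdownK h hwi
        have h2 := (hρ i _ hwi).2.2 (by simpa using hw) (by simpa using h)
        have hT : w * cs.simple i * w⁻¹ ∈ TK cs K := ⟨i, w, hw, hwi, rfl⟩
        have ht : w * (w * cs.simple i)⁻¹ = w * cs.simple i * w⁻¹ := by simp [mul_assoc]
        simp only [simple_mul_simple_cancel_right, ht] at h2
        rw [hvK hw, hvK hwi, h2]
        simp only [hb', if_pos hT, ha]
      · rw [hvK' hwi, map_zero, smul_zero, zero_add]
        by_cases hw : w ∈ K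
        · have hT : w * cs.simple i * w⁻¹ ∉ TK cs K := hdisj _ ⟨i, w, hw, hwi, rfl⟩
          simp only [hb', if_neg hT, zero_smul]
        · rw [hvK' hw, smul_zero]
  have hmem : ∀ {w : W} (i : B), w ∈ K →
      w * cs.simple i * w⁻¹ ∈ TK cs K ∨ w * cs.simple i * w⁻¹ ∈ TbK cs K := by
    intro w i hw
    by_cases hwi : w * cs.simple i ∈ K
    · exact Or.inl ⟨i, w, hw, hwi, rfl⟩
    · exact Or.inr ⟨i, w, hw, hwi, rfl⟩
  have hint : ∀ {w : W} {i : B}, cs.length w < cs.length (w * cs.simple i) →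
      ∃ k : ℤ, (k : ℝ) = ip f (αT (w * cs.simple i * w⁻¹)) := by
    intro w i h
    rw [hαT w i h]
    exact hact.exists_int hsl (ip f) hfint w i
  have hintT : ∀ t ∈ TK cs K, ∃ k : ℤ, (k : ℝ) = ip f (αT t) := by
    rintro t ⟨i, w, -, -, rfl⟩
    by_cases h : cs.length w < cs.length (w * cs.simple i)
    · exact hint h
    · have h1 := cs.length_mul_simple w i
      rw [← hflip]
      exact hint (by simp; omega)
  have hane : ∀ t ∈ TK cs K, a t ≠ 1 ∧ a t ≠ -q := by
    intro t ht
    obtain ⟨k, hk⟩ := hintT t ht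
    obtain ⟨g0, g1, g2⟩ := hgen t ht
    rw [← hk] at g0 g1 g2
    simp only [ha, ← hk]
    exact inv_qIntR_ne hq0 hqroot (by exact_mod_cast g0) (by exact_mod_cast g1)
      (by exact_mod_cast g2)
  have hrel : ∀ t, t ∈ TK cs K ∨ t ∈ TbK cs K →
      bd t * b' t = (1 - a t) * (1 - ((1 - q) - a t)) := by
    rintro t (ht | ht)
    · simp only [hb', if_pos ht, ha]
      exact hb t ht
    · simp only [hb', if_neg (hdisj t ht), ha]
      rcases hbdry t ht with h | h
      · rw [h, inv_qIntR_one hqroot]; ring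
      · rw [h, inv_qIntR_neg_one hq0 hqroot]; ring
  have hnz : ∀ t, t ∈ TK cs K ∨ t ∈ TbK cs K → ip f (αT t) ≠ 0 := by
    rintro t (ht | ht)
    · exact (hgen t ht).1
    · rcases hbdry t ht with h | h <;> simp [h]
  have hprod : ∀ t ∈ TK cs K, bd t * bBar t ≠ 0 := by
    intro t ht
    rw [hb t ht]
    refine mul_ne_zero (sub_ne_zero.2 (hane t ht).1.symm) fun h => (hane t ht).2 ?_
    simp only [ha]
    linear_combination h
  refine ⟨fun i j hij _ => ?_, fun i => ?_, fun K' hsub hne hinv => ?_⟩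
  · rcases hsl i j hij with hM | hM
    · rw [hM]
      refine ext_Cvec fun w hw => ?_
      rw [← hvK hw]
      simpa [altProd] using hedge.comm_apply hact hsl hM w
    · rw [hM]
      refine ext_Cvec fun x hxK => ?_
      rw [← hvK hxK]
      suffices ρ i (ρ j (ρ i (v x))) = ρ j (ρ i (ρ j (v x))) by simpa [altProd] using this
      obtain ⟨w, hi, hj, hx⟩ := exists_minimal_coset_rep cs hM x
      have ri := (hact.lt_iff hsl _ _).1 hi
      have rj := (hact.lt_iff hsl _ _).1 hj
      have hM' : M j i = 3 := M.symmetric i j ▸ hM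
      have sij : σ (w * cs.simple i) (Pi.single j 1) =
          σ w (Pi.single i 1) + σ w (Pi.single j 1) := by
        rw [map_mul, Module.End.mul_apply, hact.three _ _ hM, map_add, add_comm]
      have hij' : cs.length (w * cs.simple i) < cs.length (w * cs.simple i * cs.simple j) := by
        rw [hact.lt_iff hsl, sij]
        exact add_nonneg ri rj
      have hji' : cs.length (w * cs.simple j) < cs.length (w * cs.simple j * cs.simple i) := by
        rw [hact.lt_iff hsl, map_mul, Module.End.mul_apply, hact.three _ _ hM', map_add]
        exact add_nonneg ri rj
      have e5 : w * cs.simple i * cs.simple j * cs.simple i =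
          w * cs.simple j * cs.simple i * cs.simple j := by
        simpa [mul_assoc] using congrArg (w * ·) (simple_braid_of_three cs hM)
      have hiji : cs.length (w * cs.simple i * cs.simple j) <
          cs.length (w * cs.simple i * cs.simple j * cs.simple i) := by
        rw [hact.lt_iff hsl, map_mul, map_mul, Module.End.mul_apply, Module.End.mul_apply,
          hact.three _ _ hM', map_add, hact.self, hact.three _ _ hM]
        simpa using rj
      have hcases : x = w ∨ w * cs.simple i ∈ K ∨ w * cs.simple j ∈ K := by
        rcases hx with rfl | rfl | rfl | rfl | rfl | rfl
        · exact Or.inl rfl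
        · exact Or.inr (Or.inl hxK)
        · exact Or.inr (Or.inr hxK)
        · exact Or.inr (Or.inl (hdownK hij' hxK))
        · exact Or.inr (Or.inr (hdownK hji' hxK))
        · exact Or.inr (Or.inl (hdownK hij' (hdownK hiji hxK)))
      have hwK : w ∈ K := by
        rcases hcases with rfl | h | h
        · exact hxK
        · exact hdownK hi h
        · exact hdownK hj h
      by_cases hK2 : w * cs.simple i ∈ K ∨ w * cs.simple j ∈ K
      · have ht2 : w * cs.simple i * cs.simple j * (w * cs.simple i)⁻¹ ∈ TK cs K ∨
            w * cs.simple i * cs.simple j * (w * cs.simple i)⁻¹ ∈ TbK cs K := by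
          rcases hK2 with h | h
          · exact hmem j h
          · have e : w * cs.simple i * cs.simple j * (w * cs.simple i)⁻¹ =
                w * cs.simple j * cs.simple i * (w * cs.simple j)⁻¹ := by
              rw [mul_inv_rev, mul_inv_rev, inv_simple, inv_simple, ← mul_assoc, ← mul_assoc, e5]
            rw [e]
            exact hmem i h
        refine hedge.braid_apply hact hsl hM hi hj ?_ ?_ hx
        · rintro t (rfl | rfl | rfl)
          · exact hrel _ (hmem i hwK)
          · exact hrel _ (hmem j hwK)
          · exact hrel _ ht2
        · obtain ⟨k, hk⟩ := hint hi
          obtain ⟨l, hl⟩ := hint hj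
          have hkl : ((k + l : ℤ) : ℝ) =
              ip f (αT (w * cs.simple i * cs.simple j * (w * cs.simple i)⁻¹)) := by
            rw [hαT _ _ hij', sij, map_add, ← hαT _ _ hi, ← hαT _ _ hj, ← hk, ← hl, Int.cast_add]
          have n1 := hnz _ (hmem i hwK)
          have n2 := hnz _ (hmem j hwK)
          have n3 := hnz _ ht2
          rw [← hk] at n1
          rw [← hl] at n2
          rw [← hkl] at n3
          simp only [ha, ← hk, ← hl, ← hkl]
          exact inv_qIntR_mul hq0 hqroot (by exact_mod_cast n1) (by exact_mod_cast n2)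
            (by exact_mod_cast n3)
      · push Not at hK2
        obtain rfl : x = w := by tauto
        have e1 := hedge.up i x hi
        have e2 := hedge.up j x hj
        rw [hvK' hK2.1, smul_zero, add_zero] at e1
        rw [hvK' hK2.2, smul_zero, add_zero] at e2
        have e3 : a (x * cs.simple i * x⁻¹) = a (x * cs.simple j * x⁻¹) := by
          simp only [ha, hcorner x hwK i j hM hK2.1 hK2.2]
        rw [e3] at e1
        simp only [e1, e2, map_smul]
  · refine ext_Cvec fun w hw => ?_
    rw [← hvK hw, LinearMap.zero_apply]
    have hr := hrel _ (hmem i hw)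
    by_cases h : cs.length w < cs.length (w * cs.simple i)
    · exact (hecke_of_two_vectors hr (hedge.up i w h) (hedge.down i w h)).1
    · have h1 := cs.length_mul_simple w i
      have h2 : cs.length (w * cs.simple i) < cs.length (w * cs.simple i * cs.simple i) := by
        simp; omega
      rw [← hflip] at hr
      have h3 := (hecke_of_two_vectors hr (hedge.up i _ h2) (hedge.down i _ h2)).2
      simpa only [simple_mul_simple_cancel_right] using h3
  · refine hconv.eq_of_closed hsub hne fun w hw i hwi => ?_
    have hwK := hsub hw
    have hT : w * cs.simple i * w⁻¹ ∈ TK cs K := ⟨i, w, hwK, hwi, rfl⟩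
    have hx := hinv i (Cvec F K w hwK) (Submodule.subset_span ⟨w, hwK, hw, rfl⟩)
    refine mem_of_mem_spanOf hx (k := ⟨w * cs.simple i, hwi⟩) ?_
    have hne1 : w ≠ w * cs.simple i := fun e => by
      have := cs.length_mul_simple_ne w i
      rw [← e] at this
      exact this rfl
    have h1 := cs.length_mul_simple w i
    by_cases h : cs.length w < cs.length (w * cs.simple i)
    · rw [(hρ i w hwK).1 hwi h]
      simpa [Cvec, Finsupp.single_apply, hne1] using left_ne_zero_of_mul (hprod _ hT)
    · rw [(hρ i w hwK).2.2 hwi (by omega)]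
      simpa [Cvec, Finsupp.single_apply, hne1] using right_ne_zero_of_mul (hprod _ hT)
end

section
/- Let (W,S) be a finite Coxeter system, J ⊆ S, P = ⟨J⟩ the standard parabolic subgroup (itself a Coxeter system (P,J) whose length function is the restriction of ℓ), and W^J := {r ∈ W : ℓ(jr) > ℓ(r) for all j ∈ J}. Let (ψ,D) be a minimal AY pair for (P,J), with Axiom (A) coefficients a_p(m), b_p(m) (p ∈ J, m ∈ D). Set K := {mr : m ∈ D, r ∈ W^J} (every element of K has a unique such expression mr with m ∈ D, r ∈ W^J). Then there exists a representation ρ of W on V_K such that for all s ∈ S, m ∈ D, r ∈ W^J: ρ_s(C_{mr}) = C_{mrs} if rs ∈ W^J, and ρ_s(C_{mr}) = a_p(m)·C_{mr} + b_p(m)·C_{(mp)r} if rs ∉ W^J, where p := rsr⁻¹ ∈ J (and the second term is absent when mp ∉ D, since then b_p(m) = 0); moreover (ρ,K) is a minimal AY pair for W. In particular, D·W^J is a minimal AY cell for W. -/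
open CoxeterSystem

variable {B W : Type*} [Group W] {M : CoxeterMatrix B}

/-- `W^J`: the set of minimal-length representatives of the right cosets of the standard
parabolic subgroup `P = ⟨J⟩`, characterized by `ℓ(jr) > ℓ(r)` for all `j ∈ J`. -/
def minCosetReps (cs : CoxeterSystem M W) (J : Set B) : Set W :=
  {r | ∀ j ∈ J, cs.length r < cs.length (cs.simple j * r)}

/-- The set `D·W^J`. -/
def DWJ (cs : CoxeterSystem M W) (J : Set B) (D : Set W) : Set W :=
  {x | ∃ m ∈ D, ∃ r ∈ minCosetReps cs J, x = m * r}

/-- `(ρ, K)` is an AY pair: for every `s ∈ S` and `w ∈ K`, `ρ_s(C_w)` is a linear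
combination of `C_w` and `C_{ws}` (the latter being absent when `ws ∉ K`). -/
def IsAYRep (cs : CoxeterSystem M W) (F : Type*) [Field F] (K : Set W)
    (ρ : Representation F W (↥K →₀ F)) : Prop :=
  ∀ (i : B) (w : W) (hw : w ∈ K),
    (∀ h : w * cs.simple i ∈ K, ∃ a b : F,
      ρ (cs.simple i) (Cvec F K w hw) = a • Cvec F K w hw + b • Cvec F K (w * cs.simple i) h) ∧
    (w * cs.simple i ∉ K → ∃ a : F,
      ρ (cs.simple i) (Cvec F K w hw) = a • Cvec F K w hw)

/-- Minimality of a representation `ρ` of `W` on `V_K` as an AY pair. -/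
def RepMinimal {F : Type*} [Field F] (K : Set W) (ρ : Representation F W (↥K →₀ F)) : Prop :=
  K.Nonempty ∧ ∀ K' : Set W, K' ⊆ K → K'.Nonempty →
    (∀ (g : W), ∀ x ∈ spanOf F K K', ρ g x ∈ spanOf F K K') → K' = K

theorem mem_spanOf_iff {α F : Type*} [Field F] {K K' : Set α} {x : ↥K →₀ F} :
    x ∈ spanOf F K K' ↔ ∀ k : K, (k : α) ∉ K' → x k = 0 := by
  have h : {x : ↥K →₀ F | ∃ (w : α) (h : w ∈ K), w ∈ K' ∧ x = Cvec F K w h} =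
      (fun k => Finsupp.single k 1) '' {k : K | (k : α) ∈ K'} := by
    ext x
    constructor
    · rintro ⟨w, h, hw, rfl⟩
      exact ⟨⟨w, h⟩, hw, rfl⟩
    · rintro ⟨⟨w, h⟩, hw, rfl⟩
      exact ⟨w, h, hw, rfl⟩
  rw [spanOf, h, ← Finsupp.supported_eq_span_single, Finsupp.mem_supported']
  rfl

theorem Cvec_mem_spanOf_iff {α F : Type*} [Field F] {K K' : Set α} {w : α} (hw : w ∈ K) :
    Cvec F K w hw ∈ spanOf F K K' ↔ w ∈ K' := by
  refine ⟨fun h => ?_, fun h => Submodule.subset_span ⟨w, hw, h, rfl⟩⟩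
  by_contra hn
  simpa [Cvec] using mem_spanOf_iff.mp h ⟨w, hw⟩ hn

namespace CoxeterSystem

open Classical in
/-- The action of a simple reflection on pairs `(t, e)`, conjugating `t` and flipping the sign `e`
when `t` is the simple reflection itself. -/
noncomputable def signedConj (cs : CoxeterSystem M W) (i : B) : Function.End (W × ZMod 2) :=
  fun x => (cs.simple i * x.1 * cs.simple i, x.2 + if x.1 = cs.simple i then 1 else 0)

open Classical in
theorem signedConj_mul_pow (cs : CoxeterSystem M W) (i j : B) (n : ℕ) (x : W × ZMod 2) :
    ((cs.signedConj i * cs.signedConj j) ^ n) x =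
      ((cs.simple i * cs.simple j) ^ n * x.1 * ((cs.simple i * cs.simple j) ^ n)⁻¹,
        x.2 + ∑ k ∈ Finset.range (2 * n),
          if x.1 = ((cs.simple i * cs.simple j) ^ k)⁻¹ * cs.simple j then 1 else 0) := by
  have hconj : ∀ k : ℕ, cs.simple j * (cs.simple i * cs.simple j) ^ k =
      ((cs.simple i * cs.simple j) ^ k)⁻¹ * cs.simple j := by
    intro k
    induction k with
    | zero => simp
    | succ k ih =>
      rw [pow_succ, ← mul_assoc, ih, ← pow_succ, pow_succ']
      simp [mul_assoc]
  induction n with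
  | zero =>
    change x = _
    simp
  | succ n ih =>
    rw [pow_succ']
    change cs.signedConj i (cs.signedConj j (((cs.signedConj i * cs.signedConj j) ^ n) x)) = _
    rw [ih]
    set c := cs.simple i * cs.simple j with hc
    have h1 : (c ^ n * x.1 * (c ^ n)⁻¹ = cs.simple j) ↔
        x.1 = (c ^ (2 * n))⁻¹ * cs.simple j := by
      have : (c ^ (2 * n))⁻¹ * cs.simple j = (c ^ n)⁻¹ * cs.simple j * c ^ n := by
        rw [mul_assoc, hconj, two_mul, pow_add, mul_inv_rev, mul_assoc]
      rw [this]
      constructor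
      · intro h; rw [← h]; group
      · intro h; rw [h]; group
    have h2 : (cs.simple j * (c ^ n * x.1 * (c ^ n)⁻¹) * cs.simple j = cs.simple i) ↔
        x.1 = (c ^ (2 * n + 1))⁻¹ * cs.simple j := by
      have h3 : (c ^ (2 * n + 1))⁻¹ * cs.simple j =
          (c ^ n)⁻¹ * (cs.simple j * cs.simple i * cs.simple j) * c ^ n := by
        have : cs.simple j * cs.simple i = c⁻¹ := by simp [hc]
        rw [this, mul_assoc, mul_assoc, hconj, two_mul, pow_succ, pow_add]
        rw [show c⁻¹ * ((c ^ n)⁻¹ * cs.simple j) = (c ^ n * c)⁻¹ * cs.simple j by group,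
          ← pow_succ, pow_succ']
        group
      rw [h3]
      constructor
      · intro h; rw [← h]; simp [mul_assoc]
      · intro h; rw [h]; simp [mul_assoc]
    rw [show 2 * (n + 1) = 2 * n + 1 + 1 by ring, Finset.sum_range_succ, Finset.sum_range_succ]
    simp only [signedConj, h1, h2]
    refine Prod.ext ?_ ?_
    · simp [hc, pow_succ', mul_assoc]
    · simp only [add_assoc]

open Classical in
theorem isLiftable_signedConj (cs : CoxeterSystem M W) : M.IsLiftable cs.signedConj := by
  intro i j
  funext x
  have hc := cs.simple_mul_simple_pow i j
  generalize M i j = m at hc ⊢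
  have hadd (k : ℕ) : (if x.1 = ((cs.simple i * cs.simple j) ^ (m + k))⁻¹ * cs.simple j
      then (1 : ZMod 2) else 0) =
      if x.1 = ((cs.simple i * cs.simple j) ^ k)⁻¹ * cs.simple j then 1 else 0 := by
    rw [pow_add, hc, one_mul]
  rw [signedConj_mul_pow, two_mul, Finset.sum_range_add, hc,
    Finset.sum_congr rfl fun k _ => hadd k, CharTwo.add_self_eq_zero]
  change _ = x
  simp

open Classical in
theorem lift_signedConj_wordProd (cs : CoxeterSystem M W) (ω : List B) (x : W × ZMod 2) :
    cs.lift ⟨cs.signedConj, cs.isLiftable_signedConj⟩ (cs.wordProd ω) x =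
      (cs.wordProd ω * x.1 * (cs.wordProd ω)⁻¹, x.2 + (cs.rightInvSeq ω).count x.1) := by
  induction ω with
  | nil =>
    rw [wordProd_nil, map_one]
    change x = _
    simp
  | cons i ω ih =>
    rw [wordProd_cons, map_mul, lift_apply_simple]
    change cs.signedConj i (cs.lift ⟨cs.signedConj, cs.isLiftable_signedConj⟩
      (cs.wordProd ω) x) = _
    rw [ih]
    refine Prod.ext ?_ ?_
    · simp [signedConj, mul_assoc]
    · have : (cs.wordProd ω * x.1 * (cs.wordProd ω)⁻¹ = cs.simple i) ↔
          (cs.wordProd ω)⁻¹ * cs.simple i * cs.wordProd ω = x.1 := by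
        constructor
        · intro h; rw [← h]; group
        · intro h; rw [← h]; group
      simp only [signedConj, this, rightInvSeq, List.count_cons, Nat.cast_add, add_assoc]
      simp

theorem simple_mem_rightInvSeq (cs : CoxeterSystem M W) {ω : List B} {i : B}
    (h : cs.IsRightDescent (cs.wordProd ω) i) : cs.simple i ∈ cs.rightInvSeq ω := by
  classical
  obtain ⟨ω', hω', hw⟩ := cs.exists_isReduced (cs.wordProd ω * cs.simple i)
  have hprod : cs.wordProd (ω'.concat i) = cs.wordProd ω := by
    rw [wordProd_concat, ← hw]; simp
  have hred : cs.IsReduced (ω'.concat i) := by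
    rw [isRightDescent_iff, hw, hω'.eq] at h
    rw [IsReduced, hprod, ← h]; simp
  have hcount : (cs.rightInvSeq (ω'.concat i)).count (cs.simple i) = 1 :=
    List.count_eq_one_of_mem hred.nodup_rightInvSeq
      (by rw [rightInvSeq_concat]; simp)
  have h1 := cs.lift_signedConj_wordProd (ω'.concat i) (cs.simple i, 0)
  rw [hprod, lift_signedConj_wordProd, hcount] at h1
  have h2 := congrArg Prod.snd h1
  by_contra hmem
  rw [List.count_eq_zero_of_not_mem hmem] at h2
  simp at h2

/-- The exchange property. -/
theorem exists_eraseIdx_of_isLeftDescent (cs : CoxeterSystem M W) {ω : List B} {i : B}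
    (h : cs.IsLeftDescent (cs.wordProd ω) i) :
    ∃ k < ω.length, cs.simple i * cs.wordProd ω = cs.wordProd (ω.eraseIdx k) := by
  rw [← isRightDescent_inv_iff, ← wordProd_reverse] at h
  have hmem := cs.simple_mem_rightInvSeq h
  rw [rightInvSeq_reverse, List.mem_reverse] at hmem
  obtain ⟨k, hk, hki⟩ := List.mem_iff_getElem.mp hmem
  refine ⟨k, by simpa using hk, ?_⟩
  rw [← getD_leftInvSeq_mul_wordProd, List.getD_eq_getElem _ 1 hk, hki]

theorem isLeftDescent_or_exists_of_isLeftDescent_mul (cs : CoxeterSystem M W) {u v : W} {i : B}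
    (h : cs.IsLeftDescent (u * v) i) :
    cs.IsLeftDescent u i ∨
      ∃ v', cs.length v' < cs.length v ∧ cs.simple i * (u * v) = u * v' := by
  obtain ⟨α, hα, rfl⟩ := cs.exists_isReduced u
  obtain ⟨β, hβ, rfl⟩ := cs.exists_isReduced v
  rw [← wordProd_append] at h ⊢
  obtain ⟨k, hk, hw⟩ := cs.exists_eraseIdx_of_isLeftDescent h
  rw [hw]
  rcases lt_or_ge k α.length with hlt | hge
  · left
    rw [List.eraseIdx_append_of_lt_length hlt, wordProd_append, wordProd_append, ← mul_assoc] at hw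
    rw [IsLeftDescent, mul_right_cancel hw, hα.eq]
    refine (cs.length_wordProd_le _).trans_lt ?_
    rw [← List.length_eraseIdx_add_one hlt]; exact lt_add_one _
  · right
    rw [List.eraseIdx_append_of_length_le hge, wordProd_append]
    refine ⟨_, ?_, rfl⟩
    have hlt : k - α.length < β.length := by rw [List.length_append] at hk; omega
    rw [hβ.eq]
    refine (cs.length_wordProd_le _).trans_lt ?_
    rw [← List.length_eraseIdx_add_one hlt]; exact lt_add_one _

theorem exists_isReduced_of_mem_closure (cs : CoxeterSystem M W) {J : Set B} {p : W}
    (hp : p ∈ Subgroup.closure (cs.simple '' J)) :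
    ∃ ω : List B, (∀ i ∈ ω, i ∈ J) ∧ cs.IsReduced ω ∧ p = cs.wordProd ω := by
  have step : ∀ i ∈ J, ∀ p, (∃ ω : List B, (∀ i ∈ ω, i ∈ J) ∧ cs.IsReduced ω ∧
      p = cs.wordProd ω) → ∃ ω : List B, (∀ i ∈ ω, i ∈ J) ∧ cs.IsReduced ω ∧
      cs.simple i * p = cs.wordProd ω := by
    rintro i hi _ ⟨ω, hJ, hred, rfl⟩
    by_cases h : cs.IsLeftDescent (cs.wordProd ω) i
    · obtain ⟨k, hk, hw⟩ := cs.exists_eraseIdx_of_isLeftDescent h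
      refine ⟨_, fun a ha => hJ a (List.mem_of_mem_eraseIdx ha), ?_, hw⟩
      rw [isLeftDescent_iff, hw, hred.eq, ← List.length_eraseIdx_add_one hk] at h
      exact Nat.succ_injective h
    · refine ⟨i :: ω, ?_, ?_, (cs.wordProd_cons i ω).symm⟩
      · simpa using ⟨hi, hJ⟩
      · rw [not_isLeftDescent_iff, hred.eq, ← wordProd_cons] at h
        simpa [IsReduced] using h
  induction hp using Subgroup.closure_induction_left with
  | one => exact ⟨[], by simp, by simp [IsReduced], by simp⟩
  | mul_left x hx y _ ih =>
    obtain ⟨i, hi, rfl⟩ := hx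
    exact step i hi _ ih
  | inv_mul_cancel x hx y _ ih =>
    obtain ⟨i, hi, rfl⟩ := hx
    rw [inv_simple]
    exact step i hi _ ih

theorem length_wordProd_mul_of_forall_le (cs : CoxeterSystem M W) {J : Set B} {r : W}
    (hr : ∀ p ∈ Subgroup.closure (cs.simple '' J), cs.length r ≤ cs.length (p * r))
    {ω : List B} (hJ : ∀ i ∈ ω, i ∈ J) (hω : cs.IsReduced ω) :
    cs.length (cs.wordProd ω * r) = ω.length + cs.length r := by
  induction ω with
  | nil => simp
  | cons i ω ih =>
    have hred : cs.IsReduced ω := hω.drop 1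
    specialize ih (fun j hj => hJ j (List.mem_cons_of_mem _ hj)) hred
    have hmem : cs.wordProd ω ∈ Subgroup.closure (cs.simple '' J) := by
      refine Subgroup.list_prod_mem _ fun x hx => ?_
      obtain ⟨j, hj, rfl⟩ := List.mem_map.mp hx
      exact Subgroup.subset_closure ⟨j, hJ j (List.mem_cons_of_mem _ hj), rfl⟩
    have hi : cs.simple i ∈ Subgroup.closure (cs.simple '' J) :=
      Subgroup.subset_closure ⟨i, hJ i List.mem_cons_self, rfl⟩
    rw [wordProd_cons, mul_assoc]
    by_cases h : cs.IsLeftDescent (cs.wordProd ω * r) i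
    · exfalso
      rcases cs.isLeftDescent_or_exists_of_isLeftDescent_mul h with h | ⟨v, hv, hw⟩
      · rw [IsLeftDescent, ← wordProd_cons, hω.eq, hred.eq] at h
        simp at h
      · have hv' : v = ((cs.wordProd ω)⁻¹ * cs.simple i * cs.wordProd ω) * r := by
          rw [mul_assoc, mul_assoc, hw]; simp
        have := hr _ (mul_mem (mul_mem (inv_mem hmem) hi) hmem)
        rw [← hv'] at this
        omega
    · rw [not_isLeftDescent_iff, ih] at h
      rw [h, List.length_cons]; ring

theorem exists_eq_mul_minimal (cs : CoxeterSystem M W) (J : Set B) (w : W) :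
    ∃ p ∈ Subgroup.closure (cs.simple '' J), ∃ r,
      (∀ q ∈ Subgroup.closure (cs.simple '' J), cs.length r ≤ cs.length (q * r)) ∧
      w = p * r := by
  let f : Subgroup.closure (cs.simple '' J) → ℕ := fun q => cs.length (q * w)
  set q := Function.argmin f with hq
  refine ⟨_, inv_mem q.2, q * w, fun p hp => ?_, by simp⟩
  simpa [f, mul_assoc] using Function.argmin_le f (⟨p, hp⟩ * q)

theorem mem_minCosetReps_iff (cs : CoxeterSystem M W) {J : Set B} {r : W} :
    r ∈ minCosetReps cs J ↔ ∀ j ∈ J, ¬ cs.IsLeftDescent r j := by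
  refine forall₂_congr fun j _ => ?_
  rw [IsLeftDescent, not_lt]
  exact ⟨le_of_lt, fun h => lt_of_le_of_ne h (cs.length_simple_mul_ne r j).symm⟩

theorem mem_minCosetReps_of_forall_le (cs : CoxeterSystem M W) {J : Set B} {r : W}
    (hr : ∀ p ∈ Subgroup.closure (cs.simple '' J), cs.length r ≤ cs.length (p * r)) :
    r ∈ minCosetReps cs J :=
  cs.mem_minCosetReps_iff.mpr fun j hj =>
    not_lt.mpr (hr _ (Subgroup.subset_closure ⟨j, hj, rfl⟩))

theorem eq_one_of_mul_mem_minCosetReps (cs : CoxeterSystem M W) {J : Set B} {p r : W}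
    (hr : ∀ q ∈ Subgroup.closure (cs.simple '' J), cs.length r ≤ cs.length (q * r))
    (hp : p ∈ Subgroup.closure (cs.simple '' J)) (hpr : p * r ∈ minCosetReps cs J) : p = 1 := by
  obtain ⟨ω, hJ, hω, rfl⟩ := cs.exists_isReduced_of_mem_closure hp
  cases ω with
  | nil => simp
  | cons i ω =>
    exfalso
    have h1 := cs.length_wordProd_mul_of_forall_le hr hJ hω
    have h2 := cs.length_wordProd_mul_of_forall_le hr (ω := ω)
      (fun j hj => hJ j (List.mem_cons_of_mem _ hj)) (hω.drop 1)
    have h3 := hpr i (hJ i List.mem_cons_self)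
    rw [h1, wordProd_cons, mul_assoc, simple_mul_simple_cancel_left, h2, List.length_cons] at h3
    omega

theorem eq_of_mul_minCosetReps_eq (cs : CoxeterSystem M W) {J : Set B} {p p' r r' : W}
    (hp : p ∈ Subgroup.closure (cs.simple '' J)) (hp' : p' ∈ Subgroup.closure (cs.simple '' J))
    (hr : r ∈ minCosetReps cs J) (hr' : r' ∈ minCosetReps cs J) (h : p * r = p' * r') :
    p = p' ∧ r = r' := by
  obtain ⟨q, hq, r₀, hr₀, rfl⟩ := cs.exists_eq_mul_minimal J r
  obtain rfl := cs.eq_one_of_mul_mem_minCosetReps hr₀ hq hr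
  have h' : r' = p'⁻¹ * p * r₀ := by rw [mul_assoc, ← one_mul r₀, h]; simp
  subst h'
  have := cs.eq_one_of_mul_mem_minCosetReps hr₀ (mul_mem (inv_mem hp') hp) hr'
  rw [this]
  exact ⟨(inv_mul_eq_one.mp this).symm, rfl⟩

theorem exists_mul_simple_eq_of_notMem_minCosetReps (cs : CoxeterSystem M W) {J : Set B} {r : W}
    {i : B} (hr : r ∈ minCosetReps cs J) (hi : r * cs.simple i ∉ minCosetReps cs J) :
    ∃ j ∈ J, r * cs.simple i = cs.simple j * r := by
  simp only [mem_minCosetReps_iff, not_forall, not_not] at hr hi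
  obtain ⟨j, hj, h⟩ := hi
  refine ⟨j, hj, ?_⟩
  rcases cs.isLeftDescent_or_exists_of_isLeftDescent_mul h with h | ⟨v, hv, hw⟩
  · exact absurd h (hr j hj)
  · rw [length_simple, Nat.lt_one_iff, length_eq_zero_iff] at hv
    rw [hv, mul_one] at hw
    nth_rw 2 [← hw]
    simp

section InducedRepresentation

variable (cs : CoxeterSystem M W) (J : Set B)

theorem one_mem_minCosetReps : (1 : W) ∈ minCosetReps cs J := fun j _ => by simp

theorem exists_mul_minCosetReps_eq (w : W) :
    ∃ x : Subgroup.closure (cs.simple '' J) × minCosetReps cs J, w = x.1 * x.2 := by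
  obtain ⟨p, hp, r, hr, h⟩ := cs.exists_eq_mul_minimal J w
  exact ⟨⟨⟨p, hp⟩, r, cs.mem_minCosetReps_of_forall_le hr⟩, h⟩

/-- The component `p` in the decomposition `w = p * r` with `p ∈ ⟨J⟩`, `r ∈ W^J`. -/
noncomputable def parabolicPart (w : W) : Subgroup.closure (cs.simple '' J) :=
  (cs.exists_mul_minCosetReps_eq J w).choose.1

/-- The component `r` in the decomposition `w = p * r` with `p ∈ ⟨J⟩`, `r ∈ W^J`. -/
noncomputable def cosetRep (w : W) : minCosetReps cs J :=
  (cs.exists_mul_minCosetReps_eq J w).choose.2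

theorem parabolicPart_mul_cosetRep (w : W) :
    (cs.parabolicPart J w : W) * cs.cosetRep J w = w :=
  (cs.exists_mul_minCosetReps_eq J w).choose_spec.symm

variable {J}

theorem parabolicPart_cosetRep_mul (p : Subgroup.closure (cs.simple '' J))
    (r : minCosetReps cs J) :
    cs.parabolicPart J (p * r) = p ∧ cs.cosetRep J (p * r) = r := by
  have := cs.eq_of_mul_minCosetReps_eq (cs.parabolicPart J (p * r)).2 p.2
    (cs.cosetRep J (p * r)).2 r.2 (cs.parabolicPart_mul_cosetRep J (p * r))
  exact ⟨Subtype.ext this.1, Subtype.ext this.2⟩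

theorem parabolicPart_mul (p : Subgroup.closure (cs.simple '' J)) (w : W) :
    cs.parabolicPart J (p * w) = p * cs.parabolicPart J w := by
  conv_lhs => rw [← cs.parabolicPart_mul_cosetRep J w, ← mul_assoc]
  exact (cs.parabolicPart_cosetRep_mul (p * cs.parabolicPart J w) _).1

theorem cosetRep_mul (p : Subgroup.closure (cs.simple '' J)) (w : W) :
    cs.cosetRep J (p * w) = cs.cosetRep J w := by
  conv_lhs => rw [← cs.parabolicPart_mul_cosetRep J w, ← mul_assoc]
  exact (cs.parabolicPart_cosetRep_mul (p * cs.parabolicPart J w) _).2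

theorem parabolicPart_of_mem (r : minCosetReps cs J) : cs.parabolicPart J r = 1 := by
  simpa using (cs.parabolicPart_cosetRep_mul 1 r).1

theorem cosetRep_of_mem (r : minCosetReps cs J) : cs.cosetRep J r = r := by
  simpa using (cs.parabolicPart_cosetRep_mul 1 r).2

variable {F : Type*} [Field F] {D : Set W}

theorem mul_mem_DWJ {m r : W} (hm : m ∈ D) (hr : r ∈ minCosetReps cs J) : m * r ∈ DWJ cs J D :=
  ⟨m, hm, r, hr, rfl⟩

/-- The linear map `V_D → V_{D·W^J}` sending `C_m` to `C_{mr}`. -/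
noncomputable def translate (D : Set W) (r : minCosetReps cs J) :
    (↥D →₀ F) →ₗ[F] (↥(DWJ cs J D) →₀ F) :=
  Finsupp.lmapDomain F F fun m => ⟨m * r, cs.mul_mem_DWJ m.2 r.2⟩

theorem translate_Cvec (r : minCosetReps cs J) {m : W} (hm : m ∈ D) :
    cs.translate D r (Cvec F D m hm) = Cvec F (DWJ cs J D) (m * r) (cs.mul_mem_DWJ hm r.2) := by
  simp [translate, Cvec, Finsupp.mapDomain_single]

variable (ψ : Representation F (Subgroup.closure (cs.simple '' J)) (↥D →₀ F))

/-- The element `p * r` of `W`, with `p ∈ ⟨J⟩` and `r ∈ W^J`, gives the linear map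
`v ↦ ψ(p⁻¹) v ⊗ r` from `V_D` to `V_{D·W^J}`. -/
noncomputable def twistedTranslate (w : W) : (↥D →₀ F) →ₗ[F] (↥(DWJ cs J D) →₀ F) :=
  cs.translate D (cs.cosetRep J w) ∘ₗ ψ (cs.parabolicPart J w)⁻¹

theorem twistedTranslate_mul (p : Subgroup.closure (cs.simple '' J)) (w : W) (v : ↥D →₀ F) :
    cs.twistedTranslate ψ (p * w) v = cs.twistedTranslate ψ w (ψ p⁻¹ v) := by
  simp [twistedTranslate, parabolicPart_mul, cosetRep_mul]

theorem twistedTranslate_of_mem (r : minCosetReps cs J) :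
    cs.twistedTranslate ψ r = cs.translate D r := by
  ext
  simp [twistedTranslate, parabolicPart_of_mem, cosetRep_of_mem]

theorem twistedTranslate_eq (w : W) (v : ↥D →₀ F) :
    cs.twistedTranslate ψ w v =
      cs.translate D (cs.cosetRep J w) (ψ (cs.parabolicPart J w)⁻¹ v) := rfl

theorem DWJ_decomposition (k : DWJ cs J D) :
    ∃ x : D × minCosetReps cs J, (k : W) = x.1 * x.2 := by
  obtain ⟨m, hm, r, hr, h⟩ := k.2
  exact ⟨⟨⟨m, hm⟩, ⟨r, hr⟩⟩, h⟩

/-- The operator by which `g : W` acts in the induced representation. -/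
noncomputable def inducedOp (g : W) : Module.End F (↥(DWJ cs J D) →₀ F) :=
  Finsupp.lsum F fun k => LinearMap.toSpanSingleton F _
    (cs.twistedTranslate ψ ((cs.DWJ_decomposition k).choose.2 * g⁻¹)
      (Finsupp.single (cs.DWJ_decomposition k).choose.1 1))

theorem inducedOp_translate (hD : ∀ m ∈ D, m ∈ Subgroup.closure (cs.simple '' J))
    (g : W) (r : minCosetReps cs J) (v : ↥D →₀ F) :
    cs.inducedOp ψ g (cs.translate D r v) = cs.twistedTranslate ψ (r * g⁻¹) v := by
  suffices cs.inducedOp ψ g ∘ₗ cs.translate D r = cs.twistedTranslate ψ (r * g⁻¹) from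
    LinearMap.congr_fun this v
  refine Finsupp.lhom_ext' fun m => LinearMap.ext_ring ?_
  simp only [LinearMap.comp_apply, Finsupp.lsingle_apply]
  have h := cs.translate_Cvec (F := F) r m.2
  simp only [Cvec] at h
  rw [h]
  set k : DWJ cs J D := ⟨m * r, cs.mul_mem_DWJ m.2 r.2⟩ with hk
  have hspec := (cs.DWJ_decomposition k).choose_spec
  obtain ⟨h1, h2⟩ := cs.eq_of_mul_minCosetReps_eq (hD _ m.2) (hD _ (Subtype.coe_prop _)) r.2
    (Subtype.coe_prop _) hspec
  simp only [inducedOp, Finsupp.lsum_single, LinearMap.toSpanSingleton_apply, one_smul]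
  rw [← h2, ← Subtype.ext h1]

theorem inducedOp_twistedTranslate (hD : ∀ m ∈ D, m ∈ Subgroup.closure (cs.simple '' J))
    (g w : W) (v : ↥D →₀ F) :
    cs.inducedOp ψ g (cs.twistedTranslate ψ w v) = cs.twistedTranslate ψ (w * g⁻¹) v := by
  rw [twistedTranslate_eq, cs.inducedOp_translate ψ hD, ← twistedTranslate_mul, ← mul_assoc,
    parabolicPart_mul_cosetRep]

theorem DWJ_hom_ext {V : Type*} [AddCommGroup V] [Module F V]
    {f g : (↥(DWJ cs J D) →₀ F) →ₗ[F] V}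
    (h : ∀ r : minCosetReps cs J, ∀ v : ↥D →₀ F,
      f (cs.translate D r v) = g (cs.translate D r v)) : f = g := by
  refine Finsupp.lhom_ext' fun k => LinearMap.ext_ring ?_
  obtain ⟨_, m, hm, r, hr, rfl⟩ := k
  have := h ⟨r, hr⟩ (Cvec F D m hm)
  rwa [translate_Cvec] at this

/-- The representation of `W` on `V_{D·W^J}` induced from the representation `ψ` of `⟨J⟩`. -/
noncomputable def inducedRep (hD : ∀ m ∈ D, m ∈ Subgroup.closure (cs.simple '' J)) :
    Representation F W (↥(DWJ cs J D) →₀ F) where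
  toFun := cs.inducedOp ψ
  map_one' := cs.DWJ_hom_ext fun r v => by
    rw [cs.inducedOp_translate ψ hD, inv_one, mul_one, twistedTranslate_of_mem]; rfl
  map_mul' g h := cs.DWJ_hom_ext fun r v => by
    rw [Module.End.mul_apply, cs.inducedOp_translate ψ hD, cs.inducedOp_translate ψ hD,
      cs.inducedOp_twistedTranslate ψ hD, mul_inv_rev, mul_assoc]

theorem inducedRep_translate (hD : ∀ m ∈ D, m ∈ Subgroup.closure (cs.simple '' J))
    (g : W) (r : minCosetReps cs J) (v : ↥D →₀ F) :
    cs.inducedRep ψ hD g (cs.translate D r v) = cs.twistedTranslate ψ (r * g⁻¹) v :=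
  cs.inducedOp_translate ψ hD g r v

theorem inducedRep_translate_of_mul_eq (hD : ∀ m ∈ D, m ∈ Subgroup.closure (cs.simple '' J))
    {g : W} {r r' : minCosetReps cs J}
    {p : Subgroup.closure (cs.simple '' J)} (h : (p : W) * r = r' * g) (v : ↥D →₀ F) :
    cs.inducedRep ψ hD g (cs.translate D r v) = cs.translate D r' (ψ p v) := by
  have : (r : W) * g⁻¹ = (p⁻¹ : Subgroup.closure (cs.simple '' J)) * r' := by
    rw [mul_inv_eq_iff_eq_mul, Subgroup.coe_inv, mul_assoc, ← h]; simp
  rw [inducedRep_translate, this, twistedTranslate_mul, twistedTranslate_of_mem, inv_inv]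

end InducedRepresentation

theorem translate_mem_spanOf_iff (cs : CoxeterSystem M W) {F : Type*} [Field F] {J : Set B}
    {D : Set W} {K' : Set W} (r : minCosetReps cs J)
    (v : ↥D →₀ F) :
    cs.translate D r v ∈ spanOf F (DWJ cs J D) K' ↔ v ∈ spanOf F D {m | m * r ∈ K'} := by
  have hinj : Function.Injective
      (fun m : D => (⟨m * r, cs.mul_mem_DWJ m.2 r.2⟩ : DWJ cs J D)) := fun m m' h =>
    Subtype.ext (mul_right_cancel (congrArg Subtype.val h))
  simp only [mem_spanOf_iff]
  constructor
  · intro h m hm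
    rw [← h ⟨m * r, cs.mul_mem_DWJ m.2 r.2⟩ hm]
    exact (Finsupp.mapDomain_apply hinj v m).symm
  · intro h k hk
    by_cases hkr : k ∈ Set.range (fun m : D => (⟨m * r, cs.mul_mem_DWJ m.2 r.2⟩ : DWJ cs J D))
    · obtain ⟨m, rfl⟩ := hkr
      exact (Finsupp.mapDomain_apply hinj v m).trans (h m hk)
    · exact Finsupp.mapDomain_of_notMem_range v k hkr

theorem repMinimal_inducedRep (cs : CoxeterSystem M W) {F : Type*} [Field F] {J : Set B}
    {D : Set W} (ψ : Representation F (Subgroup.closure (cs.simple '' J)) (↥D →₀ F))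
    (hD : ∀ m ∈ D, m ∈ Subgroup.closure (cs.simple '' J))
    (hmin : D.Nonempty ∧ ∀ D' : Set W, D' ⊆ D → D'.Nonempty →
      (∀ (p : Subgroup.closure (cs.simple '' J)), ∀ x ∈ spanOf F D D', ψ p x ∈ spanOf F D D') →
      D' = D) :
    RepMinimal (DWJ cs J D) (cs.inducedRep ψ hD) := by
  obtain ⟨⟨m₀, hm₀⟩, hmin⟩ := hmin
  refine ⟨⟨m₀ * 1, cs.mul_mem_DWJ hm₀ (cs.one_mem_minCosetReps J)⟩, fun K' hK' hne hinv => ?_⟩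
  have hmove : ∀ m ∈ D, ∀ r r' : minCosetReps cs J, m * r ∈ K' → m * r' ∈ K' := by
    intro m hm r r' h
    rw [← Cvec_mem_spanOf_iff (F := F) (cs.mul_mem_DWJ hm r.2), ← cs.translate_Cvec r hm] at h
    have h' := hinv ((r' : W)⁻¹ * r) _ h
    rw [cs.inducedRep_translate_of_mul_eq ψ hD (p := 1) (r' := r') (by simp), map_one,
      Module.End.one_apply, cs.translate_Cvec, Cvec_mem_spanOf_iff] at h'
    exact h'
  set r₁ : minCosetReps cs J := ⟨1, cs.one_mem_minCosetReps J⟩ with hr₁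
  have hsub : ∀ {x : ↥D →₀ F}, x ∈ spanOf F D {m | m ∈ D ∧ m * r₁ ∈ K'} ↔
      x ∈ spanOf F D {m | m * r₁ ∈ K'} := by
    intro x
    simp [mem_spanOf_iff]
  have hD' : {m | m ∈ D ∧ m * r₁ ∈ K'} = D := by
    refine hmin _ (fun m hm => hm.1) ?_ fun p x hx => ?_
    · obtain ⟨k, hk⟩ := hne
      obtain ⟨m, hm, r, hr, rfl⟩ := hK' hk
      exact ⟨m, hm, hmove m hm ⟨r, hr⟩ r₁ hk⟩
    · rw [hsub, ← cs.translate_mem_spanOf_iff] at hx ⊢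
      have h' := hinv p _ hx
      rwa [cs.inducedRep_translate_of_mul_eq ψ hD (p := p) (r' := r₁) (by simp [hr₁])] at h'
  refine hK'.antisymm ?_
  rintro _ ⟨m, hm, r, hr, rfl⟩
  rw [← hD'] at hm
  exact hmove m hm.1 r₁ ⟨r, hr⟩ hm.2

end CoxeterSystem


/-- induction of minimal AY pairs from a parabolic subgroup `P = ⟨J⟩`:
from a minimal AY pair `(ψ, D)` for `(P, J)` one obtains a minimal AY pair for `W` on
the cell `K = D·W^J`, realizing the induced representation by the stated explicit
formulas. -/
theorem stmt18 [Finite W] (cs : CoxeterSystem M W) (F : Type*) [Field F]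
    (J : Set B)
    (D : Set W) (hD : ∀ m ∈ D, m ∈ Subgroup.closure (cs.simple '' J))
    -- a representation ψ of P = ⟨J⟩ on V_D, with Axiom (A) data (a, b):
    (ψ : Representation F (Subgroup.closure (cs.simple '' J)) (↥D →₀ F))
    (a b : B → W → F)
    (hψ_mem : ∀ (j : B) (hj : j ∈ J) (m : W) (hm : m ∈ D) (h : m * cs.simple j ∈ D),
      ψ ⟨cs.simple j, Subgroup.subset_closure (Set.mem_image_of_mem _ hj)⟩ (Cvec F D m hm) =
        a j m • Cvec F D m hm + b j m • Cvec F D (m * cs.simple j) h)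
    (hψ_not_mem : ∀ (j : B) (hj : j ∈ J) (m : W) (hm : m ∈ D), m * cs.simple j ∉ D →
      ψ ⟨cs.simple j, Subgroup.subset_closure (Set.mem_image_of_mem _ hj)⟩ (Cvec F D m hm) =
        a j m • Cvec F D m hm)
    (hb0 : ∀ j ∈ J, ∀ m ∈ D, m * cs.simple j ∉ D → b j m = 0)
    -- minimality of the AY pair (ψ, D) for P:
    (hmin : D.Nonempty ∧ ∀ D' : Set W, D' ⊆ D → D'.Nonempty →
      (∀ (p : Subgroup.closure (cs.simple '' J)), ∀ x ∈ spanOf F D D', ψ p x ∈ spanOf F D D') →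
      D' = D) :
    -- every element of K = D·W^J has a unique expression m·r with m ∈ D, r ∈ W^J:
    (∀ m ∈ D, ∀ m' ∈ D, ∀ r ∈ minCosetReps cs J, ∀ r' ∈ minCosetReps cs J,
      m * r = m' * r' → m = m' ∧ r = r') ∧
    -- the induced representation, given by the explicit formulas:
    ∃ ρ : Representation F W (↥(DWJ cs J D) →₀ F),
      (∀ (i : B) (m : W) (hm : m ∈ D) (r : W) (hr : r ∈ minCosetReps cs J)
          (h1 : m * r ∈ DWJ cs J D),
        (r * cs.simple i ∈ minCosetReps cs J →
          ∀ h2 : m * r * cs.simple i ∈ DWJ cs J D,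
            ρ (cs.simple i) (Cvec F (DWJ cs J D) (m * r) h1) =
              Cvec F (DWJ cs J D) (m * r * cs.simple i) h2) ∧
        (r * cs.simple i ∉ minCosetReps cs J →
          ∀ j, j ∈ J → r * cs.simple i * r⁻¹ = cs.simple j →
            (∀ h : m * cs.simple j ∈ D, ∀ h2 : m * cs.simple j * r ∈ DWJ cs J D,
              ρ (cs.simple i) (Cvec F (DWJ cs J D) (m * r) h1) =
                a j m • Cvec F (DWJ cs J D) (m * r) h1 +
                b j m • Cvec F (DWJ cs J D) (m * cs.simple j * r) h2) ∧
            (m * cs.simple j ∉ D →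
              ρ (cs.simple i) (Cvec F (DWJ cs J D) (m * r) h1) =
                a j m • Cvec F (DWJ cs J D) (m * r) h1))) ∧
      IsAYRep cs F (DWJ cs J D) ρ ∧
      RepMinimal (DWJ cs J D) ρ := by
  have hup : ∀ (i : B) (m : W) (hm : m ∈ D) (r : W) (hr : r ∈ minCosetReps cs J)
      (hri : r * cs.simple i ∈ minCosetReps cs J),
      cs.inducedRep ψ hD (cs.simple i) (Cvec F (DWJ cs J D) (m * r) (cs.mul_mem_DWJ hm hr)) =
        Cvec F (DWJ cs J D) (m * (r * cs.simple i)) (cs.mul_mem_DWJ hm hri) := by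
    intro i m hm r hr hri
    rw [← cs.translate_Cvec ⟨r, hr⟩ hm, ← cs.translate_Cvec ⟨_, hri⟩ hm,
      cs.inducedRep_translate_of_mul_eq ψ hD (p := 1) (r' := ⟨_, hri⟩) (by simp), map_one,
      Module.End.one_apply]
  have hconj : ∀ (i : B) (m : W) (hm : m ∈ D) (r : W) (hr : r ∈ minCosetReps cs J)
      (j : B) (hj : j ∈ J) (hij : r * cs.simple i = cs.simple j * r),
      cs.inducedRep ψ hD (cs.simple i) (Cvec F (DWJ cs J D) (m * r) (cs.mul_mem_DWJ hm hr)) =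
        cs.translate D ⟨r, hr⟩ (ψ ⟨cs.simple j,
          Subgroup.subset_closure (Set.mem_image_of_mem _ hj)⟩ (Cvec F D m hm)) := by
    intro i m hm r hr j hj hij
    rw [← cs.translate_Cvec ⟨r, hr⟩ hm]
    exact cs.inducedRep_translate_of_mul_eq ψ hD hij.symm _
  have hmem : ∀ (i : B) (m : W) (hm : m ∈ D) (r : W) (hr : r ∈ minCosetReps cs J)
      (j : B) (_ : j ∈ J) (_ : r * cs.simple i = cs.simple j * r) (h : m * cs.simple j ∈ D),
      cs.inducedRep ψ hD (cs.simple i) (Cvec F (DWJ cs J D) (m * r) (cs.mul_mem_DWJ hm hr)) =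
        a j m • Cvec F (DWJ cs J D) (m * r) (cs.mul_mem_DWJ hm hr) +
        b j m • Cvec F (DWJ cs J D) (m * cs.simple j * r) (cs.mul_mem_DWJ h hr) := by
    intro i m hm r hr j hj hij h
    rw [hconj i m hm r hr j hj hij, hψ_mem j hj m hm h, map_add, map_smul, map_smul,
      cs.translate_Cvec, cs.translate_Cvec]
  have hnot_mem : ∀ (i : B) (m : W) (hm : m ∈ D) (r : W) (hr : r ∈ minCosetReps cs J)
      (j : B) (_ : j ∈ J) (_ : r * cs.simple i = cs.simple j * r) (_ : m * cs.simple j ∉ D),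
      cs.inducedRep ψ hD (cs.simple i) (Cvec F (DWJ cs J D) (m * r) (cs.mul_mem_DWJ hm hr)) =
        a j m • Cvec F (DWJ cs J D) (m * r) (cs.mul_mem_DWJ hm hr) := by
    intro i m hm r hr j hj hij h
    rw [hconj i m hm r hr j hj hij, hψ_not_mem j hj m hm h, map_smul, cs.translate_Cvec]
  refine ⟨fun m hm m' hm' r hr r' hr' h =>
    cs.eq_of_mul_minCosetReps_eq (hD m hm) (hD m' hm') hr hr' h,
    cs.inducedRep ψ hD, fun i m hm r hr h1 => ⟨fun hri h2 => ?_, fun _ j hj hij => ?_⟩, ?_,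
    cs.repMinimal_inducedRep ψ hD hmin⟩
  · rw [hup i m hm r hr hri]
    congr 1
    exact (mul_assoc _ _ _).symm
  · rw [mul_inv_eq_iff_eq_mul] at hij
    exact ⟨fun h _ => hmem i m hm r hr j hj hij h, hnot_mem i m hm r hr j hj hij⟩
  · rintro i _ ⟨m, hm, r, hr, rfl⟩
    by_cases hri : r * cs.simple i ∈ minCosetReps cs J
    · refine ⟨fun h => ⟨0, 1, ?_⟩, fun h => absurd ⟨m, hm, _, hri, mul_assoc _ _ _⟩ h⟩
      rw [hup i m hm r hr hri, zero_smul, zero_add, one_smul]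
      congr 1
      exact (mul_assoc _ _ _).symm
    · obtain ⟨j, hj, hij⟩ := cs.exists_mul_simple_eq_of_notMem_minCosetReps hr hri
      have hmrs : m * r * cs.simple i = m * cs.simple j * r := by
        rw [mul_assoc, hij, mul_assoc]
      by_cases h : m * cs.simple j ∈ D
      · refine ⟨fun _ => ⟨a j m, b j m, ?_⟩, fun h' => absurd ⟨_, h, r, hr, hmrs⟩ h'⟩
        rw [hmem i m hm r hr j hj hij h]
        congr 3
        exact hmrs.symm
      · refine ⟨fun _ => ⟨a j m, 0, ?_⟩, fun _ => ⟨a j m, hnot_mem i m hm r hr j hj hij h⟩⟩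
        rw [hnot_mem i m hm r hr j hj hij h, zero_smul, add_zero]
end
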